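/- Let n ≥ 1, α₁,…,αₙ > 0, and let μ be the probability measure on ℝⁿ with density e^{−Φ(u)}, where Φ(u) = ½·Σᵢ αᵢuᵢ² + ln(∏ᵢ √(2π/αᵢ)). For f ∈ C_c^∞(ℝⁿ) with ∫ f dμ = 0, set g = f − L_OU f, where L_OU f = Σᵢ (∂²f/∂uᵢ² − αᵢ·uᵢ·∂f/∂uᵢ). Then ∫ |∇Φ(u)|²·|∇f(u)|² μ(du) ≤ 4·(4 + Σᵢ αᵢ)·∫ g² dμ, where |·| denotes the Euclidean norm on ℝⁿ. -/

import Mathlib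

open Real MeasureTheory

/-- Partial derivative in the `i`-th coordinate direction. -/
noncomputable def pd {n : ℕ} (f : EuclideanSpace ℝ (Fin n) → ℝ) (i : Fin n)
    (u : EuclideanSpace ℝ (Fin n)) : ℝ :=
  fderiv ℝ f u (EuclideanSpace.single i 1)

/-- `Φ(u) = ½·Σᵢ αᵢuᵢ² + ln(∏ᵢ √(2π/αᵢ))`, the normalized Gaussian potential. -/
noncomputable def gaussPhi {n : ℕ} (α : Fin n → ℝ) (u : EuclideanSpace ℝ (Fin n)) : ℝ :=
  (1 / 2) * ∑ i, α i * (u i) ^ 2 + Real.log (∏ i, Real.sqrt (2 * π / α i))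

/-- The Gaussian probability measure `μ(du) = e^{−Φ(u)} du` on `ℝⁿ`. -/
noncomputable def gaussMeasure {n : ℕ} (α : Fin n → ℝ) :
    Measure (EuclideanSpace ℝ (Fin n)) :=
  volume.withDensity fun u => ENNReal.ofReal (Real.exp (-(gaussPhi α u)))

/-- The Ornstein–Uhlenbeck operator `L f = Σᵢ (∂²f/∂uᵢ² − αᵢ·uᵢ·∂f/∂uᵢ)`. -/
noncomputable def ouOp {n : ℕ} (α : Fin n → ℝ) (f : EuclideanSpace ℝ (Fin n) → ℝ)
    (u : EuclideanSpace ℝ (Fin n)) : ℝ :=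
  ∑ i, (pd (pd f i) i u - α i * u i * pd f i u)

/-- Smooth, compactly supported real functions on `ℝⁿ`. -/
structure IsTestFun {n : ℕ} (φ : EuclideanSpace ℝ (Fin n) → ℝ) : Prop where
  contDiff : ContDiff ℝ (⊤ : ℕ∞) φ
  compactSupport : HasCompactSupport φ

section PartialDerivatives

variable {n : ℕ} {φ ψ : EuclideanSpace ℝ (Fin n) → ℝ}

lemma contDiff_coord (i : Fin n) :
    ContDiff ℝ (⊤ : ℕ∞) fun u : EuclideanSpace ℝ (Fin n) => u i :=
  (EuclideanSpace.proj (𝕜 := ℝ) i).contDiff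

lemma contDiff_pd (hφ : ContDiff ℝ (⊤ : ℕ∞) φ) (i : Fin n) :
    ContDiff ℝ (⊤ : ℕ∞) (pd φ i) :=
  (hφ.fderiv_right (m := (⊤ : ℕ∞)) (by norm_cast)).clm_apply contDiff_const

lemma pd_mul {u : EuclideanSpace ℝ (Fin n)} (hφ : DifferentiableAt ℝ φ u)
    (hψ : DifferentiableAt ℝ ψ u) (i : Fin n) :
    pd (fun v => φ v * ψ v) i u = pd φ i u * ψ u + φ u * pd ψ i u := by
  simp only [pd, fderiv_fun_mul hφ hψ, add_apply, smul_apply, smul_eq_mul]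
  ring

lemma pd_const_mul_coord (c : ℝ) (i j : Fin n) (u : EuclideanSpace ℝ (Fin n)) :
    pd (fun v => c * v i) j u = if i = j then c else 0 := by
  have h : HasFDerivAt (fun v : EuclideanSpace ℝ (Fin n) => c * v i)
      (c • (EuclideanSpace.proj (𝕜 := ℝ) i : EuclideanSpace ℝ (Fin n) →L[ℝ] ℝ)) u :=
    (EuclideanSpace.proj (𝕜 := ℝ) i).hasFDerivAt.const_mul c
  simp [pd, h.fderiv, PiLp.single_apply]

lemma pd_comm (hφ : ContDiff ℝ (⊤ : ℕ∞) φ) (i j : Fin n) (u : EuclideanSpace ℝ (Fin n)) :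
    pd (pd φ i) j u = pd (pd φ j) i u := by
  have hd : DifferentiableAt ℝ (fderiv ℝ φ) u :=
    ((hφ.fderiv_right (m := (⊤ : ℕ∞)) (by norm_cast)).differentiable (by simp)) u
  have key (k l : Fin n) : pd (pd φ k) l u =
      fderiv ℝ (fderiv ℝ φ) u (EuclideanSpace.single l 1) (EuclideanSpace.single k 1) := by
    change fderiv ℝ (fun v => fderiv ℝ φ v (EuclideanSpace.single k 1)) u _ = _
    rw [fderiv_clm_apply hd (differentiableAt_const _)]
    simp
  rw [key, key]
  exact hφ.contDiffAt.isSymmSndFDerivAt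
    (by rw [minSmoothness_of_isRCLikeNormedField]; exact WithTop.coe_le_coe.2 (le_top : (2 : ℕ∞) ≤ ⊤)) _ _

lemma contDiff_ouOp (α : Fin n → ℝ) (hφ : ContDiff ℝ (⊤ : ℕ∞) φ) :
    ContDiff ℝ (⊤ : ℕ∞) (ouOp α φ) :=
  ContDiff.sum fun i _ => (contDiff_pd (contDiff_pd hφ i) i).sub
    ((contDiff_const.mul (contDiff_coord i)).mul (contDiff_pd hφ i))

lemma pd_ouOp (α : Fin n → ℝ) (hφ : ContDiff ℝ (⊤ : ℕ∞) φ) (i : Fin n)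
    (u : EuclideanSpace ℝ (Fin n)) :
    pd (ouOp α φ) i u = ouOp α (pd φ i) u - α i * pd φ i u := by
  have hd {χ : EuclideanSpace ℝ (Fin n) → ℝ} (h : ContDiff ℝ (⊤ : ℕ∞) χ) :
      DifferentiableAt ℝ χ u := h.differentiable (by simp) u
  have hlin (j : Fin n) := (contDiff_const (c := α j)).mul (contDiff_coord j)
  have hterm (j : Fin n) : pd (fun v => pd (pd φ j) j v - α j * v j * pd φ j v) i u =
      pd (pd (pd φ i) j) j u - α j * u j * pd (pd φ i) j u -
        (if j = i then α j else 0) * pd φ j u := by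
    have hsub : pd (fun v => pd (pd φ j) j v - α j * v j * pd φ j v) i u =
        pd (pd (pd φ j) j) i u - pd (fun v => α j * v j * pd φ j v) i u := by
      change fderiv ℝ (fun v => pd (pd φ j) j v - α j * v j * pd φ j v) u _ = _
      rw [fderiv_fun_sub (hd (contDiff_pd (contDiff_pd hφ j) j))
        (hd ((hlin j).mul (contDiff_pd hφ j)))]
      rfl
    have hcomm : pd (pd φ j) i = pd (pd φ i) j := funext (pd_comm hφ j i)
    rw [hsub, pd_mul (hd (hlin j)) (hd (contDiff_pd hφ j)), pd_const_mul_coord,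
      pd_comm (contDiff_pd hφ j), hcomm]
    ring
  have hsum : pd (ouOp α φ) i u =
      ∑ j, pd (fun v => pd (pd φ j) j v - α j * v j * pd φ j v) i u := by
    change fderiv ℝ (fun v => ∑ j, (pd (pd φ j) j v - α j * v j * pd φ j v)) u _ = _
    rw [fderiv_fun_sum fun j _ => hd ((contDiff_pd (contDiff_pd hφ j) j).sub
      ((hlin j).mul (contDiff_pd hφ j)))]
    simp [pd]
  rw [hsum, Finset.sum_congr rfl fun j _ => hterm j, Finset.sum_sub_distrib]
  simp [ouOp]

end PartialDerivatives

namespace IsTestFun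

variable {n : ℕ} {φ ψ : EuclideanSpace ℝ (Fin n) → ℝ}

lemma differentiable (hφ : IsTestFun φ) : Differentiable ℝ φ :=
  hφ.contDiff.differentiable (by simp)

lemma mul_left (hφ : IsTestFun φ) (hψ : ContDiff ℝ (⊤ : ℕ∞) ψ) :
    IsTestFun fun u => ψ u * φ u :=
  ⟨hψ.mul hφ.contDiff, hφ.compactSupport.mul_left⟩

lemma mul (hφ : IsTestFun φ) (hψ : IsTestFun ψ) : IsTestFun fun u => φ u * ψ u :=
  hψ.mul_left hφ.contDiff

lemma sq (hφ : IsTestFun φ) : IsTestFun fun u => φ u ^ 2 := by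
  simpa only [pow_two] using hφ.mul hφ

lemma const_mul (hφ : IsTestFun φ) (c : ℝ) : IsTestFun fun u => c * φ u :=
  hφ.mul_left contDiff_const

lemma add (hφ : IsTestFun φ) (hψ : IsTestFun ψ) : IsTestFun fun u => φ u + ψ u :=
  ⟨hφ.contDiff.add hψ.contDiff, hφ.compactSupport.add hψ.compactSupport⟩

lemma sub (hφ : IsTestFun φ) (hψ : IsTestFun ψ) : IsTestFun fun u => φ u - ψ u :=
  ⟨hφ.contDiff.sub hψ.contDiff, hφ.compactSupport.sub hψ.compactSupport⟩

lemma sum {ι : Type*} (s : Finset ι) {χ : ι → EuclideanSpace ℝ (Fin n) → ℝ}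
    (hχ : ∀ i, IsTestFun (χ i)) : IsTestFun fun u => ∑ i ∈ s, χ i u := by
  classical
  induction s using Finset.induction_on with
  | empty => simpa using ⟨contDiff_const, HasCompactSupport.zero⟩
  | insert i s hi ih =>
    simp only [Finset.sum_insert hi]
    exact (hχ i).add ih

lemma pd (hφ : IsTestFun φ) (i : Fin n) : IsTestFun (pd φ i) :=
  ⟨contDiff_pd hφ.contDiff i, hφ.compactSupport.fderiv_apply (𝕜 := ℝ) _⟩

lemma linear_mul (hφ : IsTestFun φ) (c : ℝ) (i : Fin n) :
    IsTestFun fun u => c * u i * φ u :=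
  hφ.mul_left (contDiff_const.mul (contDiff_coord i))

lemma ouOp (hφ : IsTestFun φ) (α : Fin n → ℝ) : IsTestFun (ouOp α φ) :=
  IsTestFun.sum _ fun i => ((hφ.pd i).pd i).sub ((hφ.pd i).linear_mul (α i) i)

end IsTestFun

section Gaussian

variable {n : ℕ} {φ ψ : EuclideanSpace ℝ (Fin n) → ℝ} (α : Fin n → ℝ)

lemma contDiff_gaussPhi : ContDiff ℝ (⊤ : ℕ∞) (gaussPhi α) :=
  (contDiff_const.mul (ContDiff.sum fun i _ =>
    contDiff_const.mul ((contDiff_coord i).pow 2))).add contDiff_const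

lemma pd_gaussPhi (i : Fin n) (u : EuclideanSpace ℝ (Fin n)) :
    pd (gaussPhi α) i u = α i * u i := by
  have hc (j : Fin n) : HasFDerivAt (fun v : EuclideanSpace ℝ (Fin n) => v j)
      (EuclideanSpace.proj (𝕜 := ℝ) j : EuclideanSpace ℝ (Fin n) →L[ℝ] ℝ) u :=
    (EuclideanSpace.proj (𝕜 := ℝ) j).hasFDerivAt
  have h := (((HasFDerivAt.fun_sum (u := Finset.univ) fun j _ =>
    ((hc j).pow 2).const_mul (α j)).const_mul (1 / 2 : ℝ)).add_const
      (Real.log (∏ j, Real.sqrt (2 * π / α j))))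
  change fderiv ℝ (fun v => gaussPhi α v) u _ = _
  simp only [gaussPhi]
  rw [h.fderiv]
  simp [PiLp.single_apply]
  ring

instance : IsLocallyFiniteMeasure (gaussMeasure α) :=
  IsLocallyFiniteMeasure.withDensity_ofReal (contDiff_gaussPhi α).continuous.neg.rexp

lemma IsTestFun.integrable (hφ : IsTestFun φ) : Integrable φ (gaussMeasure α) :=
  hφ.contDiff.continuous.integrable_of_hasCompactSupport hφ.compactSupport

lemma integral_gaussMeasure (φ : EuclideanSpace ℝ (Fin n) → ℝ) :
    ∫ u, φ u ∂(gaussMeasure α) = ∫ u, Real.exp (-(gaussPhi α u)) * φ u := by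
  have hm : Measurable fun u => ENNReal.ofReal (Real.exp (-(gaussPhi α u))) :=
    (contDiff_gaussPhi α).continuous.neg.rexp.measurable.ennreal_ofReal
  rw [gaussMeasure, integral_withDensity_eq_integral_toReal_smul hm (by simp)]
  simp [ENNReal.toReal_ofReal (Real.exp_pos _).le]

/-- The Gaussian divergence formula. -/
lemma integral_pd_gaussMeasure (hφ : IsTestFun φ) (i : Fin n) :
    ∫ u, pd φ i u ∂(gaussMeasure α) = ∫ u, α i * u i * φ u ∂(gaussMeasure α) := by
  have hρ : ContDiff ℝ (⊤ : ℕ∞) fun u => Real.exp (-(gaussPhi α u)) :=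
    (contDiff_gaussPhi α).neg.exp
  have hpd (u : EuclideanSpace ℝ (Fin n)) :
      pd (fun u => Real.exp (-(gaussPhi α u))) i u =
        -(Real.exp (-(gaussPhi α u)) * (α i * u i)) := by
    have h := ((contDiff_gaussPhi α).differentiable (by simp) u).hasFDerivAt.neg.exp
    rw [← pd_gaussPhi α i u]
    change fderiv ℝ (fun v => Real.exp (-(gaussPhi α v))) u _ = _
    erw [h.fderiv]
    simp [pd]
  have hint {χ : EuclideanSpace ℝ (Fin n) → ℝ} (hχ : IsTestFun χ) : Integrable χ :=
    hχ.contDiff.continuous.integrable_of_hasCompactSupport hχ.compactSupport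
  have key := integral_mul_fderiv_eq_neg_fderiv_mul_of_integrable (μ := volume)
    (v := EuclideanSpace.single i (1 : ℝ))
    (hint (hφ.mul_left (contDiff_pd hρ i))) (hint ((hφ.pd i).mul_left hρ))
    (hint (hφ.mul_left hρ)) (fun u _ => hρ.differentiable (by simp) u)
    (fun u _ => hφ.differentiable u)
  rw [integral_gaussMeasure, integral_gaussMeasure]
  refine key.trans ?_
  rw [← integral_neg]
  refine integral_congr_ae (.of_forall fun u => ?_)
  have := hpd u
  simp only [pd] at this
  simp only [this]
  ring

lemma integral_mul_pd_sub (hφ : IsTestFun φ) (hψ : IsTestFun ψ) (i : Fin n) :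
    ∫ u, φ u * (pd ψ i u - α i * u i * ψ u) ∂(gaussMeasure α) =
      -∫ u, pd φ i u * ψ u ∂(gaussMeasure α) := by
  have h := integral_pd_gaussMeasure α (hφ.mul hψ) i
  simp only [pd_mul (hφ.differentiable _) (hψ.differentiable _)] at h
  rw [integral_add (((hφ.pd i).mul hψ).integrable α) ((hφ.mul (hψ.pd i)).integrable α)] at h
  have hsub := integral_sub ((hφ.mul (hψ.pd i)).integrable α)
    (((hφ.mul hψ).linear_mul (α i) i).integrable α)
  rw [← h] at hsub
  calc _ = ∫ u, φ u * pd ψ i u - α i * u i * (φ u * ψ u) ∂(gaussMeasure α) := by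
        congr 1; ext u; ring
    _ = _ := by rw [hsub]; ring

lemma integral_mul_ouOp (hφ : IsTestFun φ) (hψ : IsTestFun ψ) :
    ∫ u, φ u * ouOp α ψ u ∂(gaussMeasure α) =
      -∑ i, ∫ u, pd φ i u * pd ψ i u ∂(gaussMeasure α) := by
  simp only [ouOp, Finset.mul_sum]
  rw [integral_finsetSum _ fun i _ =>
    (hφ.mul (((hψ.pd i).pd i).sub ((hψ.pd i).linear_mul (α i) i))).integrable α,
    ← Finset.sum_neg_distrib]
  exact Finset.sum_congr rfl fun i _ => integral_mul_pd_sub α hφ (hψ.pd i) i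

/-- The integrated Bochner identity for the Ornstein–Uhlenbeck operator. -/
lemma integral_ouOp_sq (hφ : IsTestFun φ) :
    ∫ u, ouOp α φ u ^ 2 ∂(gaussMeasure α) =
      ∑ i, ((∑ j, ∫ u, pd (pd φ i) j u ^ 2 ∂(gaussMeasure α)) +
        α i * ∫ u, pd φ i u ^ 2 ∂(gaussMeasure α)) := by
  simp only [pow_two]
  rw [integral_mul_ouOp α (hφ.ouOp α) hφ, ← Finset.sum_neg_distrib]
  refine Finset.sum_congr rfl fun i _ => ?_
  have hi := hφ.pd i
  have h := integral_mul_ouOp α hi hi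
  have hsub := integral_sub ((hi.mul (hi.ouOp α)).integrable α)
    (((hi.mul hi).const_mul (α i)).integrable α)
  rw [h, integral_const_mul] at hsub
  calc _ = -∫ u, pd φ i u * ouOp α (pd φ i) u - α i * (pd φ i u * pd φ i u)
          ∂(gaussMeasure α) := by
        congr 2; ext u; rw [pd_ouOp α hφ.contDiff]; ring
    _ = _ := by rw [hsub]; ring

lemma integral_linear_mul_sq_le (hφ : IsTestFun φ) (i : Fin n) :
    ∫ u, (α i * u i) ^ 2 * φ u ^ 2 ∂(gaussMeasure α) ≤
      2 * α i * (∫ u, φ u ^ 2 ∂(gaussMeasure α)) +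
        4 * ∫ u, pd φ i u ^ 2 ∂(gaussMeasure α) := by
  have hlin := contDiff_const.mul (contDiff_coord i) (f := fun _ => α i)
  have hw : IsTestFun fun u => (α i * u i) ^ 2 * φ u ^ 2 := hφ.sq.mul_left (hlin.pow 2)
  have hφi := hφ.pd i
  have h := integral_pd_gaussMeasure α (hφ.sq.linear_mul (α i) i) i
  have hpd (u : EuclideanSpace ℝ (Fin n)) : pd (fun v => α i * v i * φ v ^ 2) i u =
      α i * φ u ^ 2 + 2 * (α i * u i * (φ u * pd φ i u)) := by
    simp only [pow_two]
    rw [pd_mul (hlin.differentiable (by simp) u) ((hφ.mul hφ).differentiable u),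
      pd_mul (hφ.differentiable u) (hφ.differentiable u), pd_const_mul_coord, if_pos rfl]
    ring
  simp only [hpd] at h
  have hsum := (hφ.sq.const_mul (α i)).add (hw.const_mul (1 / 2))
  have hle : ∫ u, (α i * φ u ^ 2 + 2 * (α i * u i * (φ u * pd φ i u))) ∂(gaussMeasure α) ≤
      ∫ u, ((α i * φ u ^ 2 + (1 / 2) * ((α i * u i) ^ 2 * φ u ^ 2)) + 2 * pd φ i u ^ 2)
        ∂(gaussMeasure α) := by
    refine integral_mono
      (((hφ.sq.const_mul (α i)).add (((hφ.mul hφi).linear_mul (α i) i).const_mul 2)).integrable α)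
      ((hsum.add (hφi.sq.const_mul 2)).integrable α) fun u => ?_
    simp only
    nlinarith [sq_nonneg (α i * u i * φ u - 2 * pd φ i u)]
  rw [integral_add (hsum.integrable α) ((hφi.sq.const_mul 2).integrable α),
    integral_add ((hφ.sq.const_mul (α i)).integrable α) ((hw.const_mul (1 / 2)).integrable α),
    integral_const_mul, integral_const_mul, integral_const_mul, h] at hle
  have heq : ∫ u, α i * u i * (α i * u i * φ u ^ 2) ∂(gaussMeasure α) =
      ∫ u, (α i * u i) ^ 2 * φ u ^ 2 ∂(gaussMeasure α) := by
    congr 1; ext u; ring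
  rw [heq] at hle
  linarith

lemma integral_sub_ouOp_sq (hφ : IsTestFun φ) :
    ∫ u, (φ u - ouOp α φ u) ^ 2 ∂(gaussMeasure α) =
      (∫ u, φ u ^ 2 ∂(gaussMeasure α)) + 2 * (∑ i, ∫ u, pd φ i u ^ 2 ∂(gaussMeasure α)) +
        ∫ u, ouOp α φ u ^ 2 ∂(gaussMeasure α) := by
  have hL := hφ.ouOp α
  have hc := (hφ.mul hL).const_mul 2
  have h := integral_mul_ouOp α hφ hφ
  simp only [← pow_two] at h
  calc _ = ∫ u, φ u ^ 2 - 2 * (φ u * ouOp α φ u) + ouOp α φ u ^ 2 ∂(gaussMeasure α) := by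
        congr 1; ext u; ring
    _ = _ := by
        rw [integral_add ((hφ.sq.sub hc).integrable α) (hL.sq.integrable α),
          integral_sub (hφ.sq.integrable α) (hc.integrable α),
          integral_const_mul, h]
        ring

end Gaussian

/-- for `f ∈ C_c^∞(ℝⁿ)` with `∫ f dμ = 0` and `g = f − L_OU f`,
one has `∫ |∇Φ|²·|∇f|² dμ ≤ 4(4 + Σᵢ αᵢ)·∫ g² dμ`, where
`∇Φ(u) = (α₁u₁,…,αₙuₙ)`. -/
theorem stmt_18 (n : ℕ) (hn : 1 ≤ n) (α : Fin n → ℝ) (hα : ∀ i, 0 < α i)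
    (f : EuclideanSpace ℝ (Fin n) → ℝ)
    (hf : ContDiff ℝ (⊤ : ℕ∞) f) (hsupp : HasCompactSupport f)
    (hmean : ∫ u, f u ∂(gaussMeasure α) = 0) :
    (∫ u, (∑ i, (α i * u i) ^ 2) * (∑ i, (pd f i u) ^ 2) ∂(gaussMeasure α)) ≤
      4 * (4 + ∑ i, α i) * (∫ u, (f u - ouOp α f u) ^ 2 ∂(gaussMeasure α)) := by
  have hT : IsTestFun f := ⟨hf, hsupp⟩
  set μ := gaussMeasure α
  have hlhs : (∫ u, (∑ i, (α i * u i) ^ 2) * (∑ i, (pd f i u) ^ 2) ∂μ) =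
      ∑ i, ∑ j, ∫ u, (α i * u i) ^ 2 * pd f j u ^ 2 ∂μ := by
    have hint (i j : Fin n) : Integrable (fun u => (α i * u i) ^ 2 * pd f j u ^ 2) μ :=
      ((hT.pd j).sq.mul_left ((contDiff_const.mul (contDiff_coord i)).pow 2)).integrable α
    simp only [Finset.sum_mul_sum]
    rw [integral_finsetSum _ fun i _ => integrable_finsetSum _ fun j _ => hint i j]
    exact Finset.sum_congr rfl fun i _ => integral_finsetSum _ fun j _ => hint i j
  have hgrad : ∀ i, 0 ≤ ∫ u, pd f i u ^ 2 ∂μ := fun i =>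
    integral_nonneg fun u => sq_nonneg _
  have hhess : 0 ≤ ∑ i, ∑ j, ∫ u, pd (pd f j) i u ^ 2 ∂μ :=
    Finset.sum_nonneg fun i _ => Finset.sum_nonneg fun j _ =>
      integral_nonneg fun u => sq_nonneg _
  have hbound : ∑ i, ∑ j, ∫ u, (α i * u i) ^ 2 * pd f j u ^ 2 ∂μ ≤
      2 * (∑ i, α i) * (∑ j, ∫ u, pd f j u ^ 2 ∂μ) +
        4 * ∑ i, ∑ j, ∫ u, pd (pd f j) i u ^ 2 ∂μ := by
    refine (Finset.sum_le_sum fun i _ => Finset.sum_le_sum fun j _ =>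
      integral_linear_mul_sq_le α (hT.pd j) i).trans_eq ?_
    simp only [Finset.sum_add_distrib, ← Finset.mul_sum, ← Finset.sum_mul]
    rfl
  have hsq : ∑ i, ∑ j, ∫ u, pd (pd f j) i u ^ 2 ∂μ ≤ ∫ u, ouOp α f u ^ 2 ∂μ := by
    rw [integral_ouOp_sq α hT, Finset.sum_add_distrib, Finset.sum_comm]
    exact le_add_of_nonneg_right
      (Finset.sum_nonneg fun i _ => mul_nonneg (hα i).le (hgrad i))
  have hS : 0 ≤ ∑ i, α i := Finset.sum_nonneg fun i _ => (hα i).le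
  have hG : 0 ≤ ∑ i, ∫ u, pd f i u ^ 2 ∂μ := Finset.sum_nonneg fun i _ => hgrad i
  have hF : 0 ≤ ∫ u, f u ^ 2 ∂μ := integral_nonneg fun u => sq_nonneg _
  rw [hlhs, integral_sub_ouOp_sq α hT]
  refine hbound.trans ?_
  have hL := hhess.trans hsq
  nlinarith [mul_nonneg hS hG, mul_nonneg hS hF, mul_nonneg hS hL]
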